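/- Let F be ℝ or ℂ, let p, q ≥ 1, and let λ ∈ F. For every pair M, N ∈ F^{p×q}: if λ ≠ 0, there exist S, R ∈ F^{p×q} with M + S J_q − R = 0 and N + R − J_p(λ) S = 0; if λ = 0, there exist S, R ∈ F^{p×q} and a matrix H ∈ F^{p×q} of form (5.1) (zero outside its first column if p ≤ q, zero outside its last row if p > q) with M + S J_q − R = 0 and N + R − J_p S = H, and H is uniquely determined by (M,N). -/

import Mathlib

open Matrix

/-- The `r × r` upper-triangular Jordan block `J_r(lam)`; `J_r := J_r(0)`. -/
def jordanBlock (F : Type*) [Zero F] [One F] (r : ℕ) (lam : F) :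
    Matrix (Fin r) (Fin r) F :=
  Matrix.of fun i j =>
    if (i : ℕ) = (j : ℕ) then lam else if (j : ℕ) = (i : ℕ) + 1 then 1 else 0

/-- A `p × q` matrix `H` is of form (5.1) if: in case `p ≤ q` all entries outside its
first column are zero, and in case `p > q` all entries outside its last row are zero. -/
def IsForm51 {F : Type*} [Zero F] {p q : ℕ} (H : Matrix (Fin p) (Fin q) F) : Prop :=
  if p ≤ q then ∀ (i : Fin p) (j : Fin q), (j : ℕ) ≠ 0 → H i j = 0
  else ∀ (i : Fin p) (j : Fin q), (i : ℕ) ≠ p - 1 → H i j = 0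

/-- The `p × q` matrix read off from a grid `U`, rows being counted from the bottom and both indices
starting at `1`. When `U` vanishes on its axes, neighbouring entries outside the matrix read as `0`. -/
def ofGrid {F : Type*} (p q : ℕ) (U : ℕ → ℕ → F) : Matrix (Fin p) (Fin q) F :=
  Matrix.of fun i j => U (p - i) (j + 1)

/-- Every matrix comes from a grid that vanishes on its axes. -/
theorem exists_ofGrid_eq {F : Type*} [Zero F] {p q : ℕ} (S : Matrix (Fin p) (Fin q) F) :
    ∃ U : ℕ → ℕ → F, (∀ j, U 0 j = 0) ∧ (∀ k, U k 0 = 0) ∧ ofGrid p q U = S := by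
  refine ⟨fun k j => if h : (0 < k ∧ k ≤ p) ∧ (0 < j ∧ j ≤ q) then
    S ⟨p - k, by omega⟩ ⟨j - 1, by omega⟩ else 0, by simp, by simp, ?_⟩
  ext i j
  have hi := i.isLt
  have hj := j.isLt
  simp only [ofGrid, Matrix.of_apply]
  rw [dif_pos (by omega)]
  congr 1
  ext
  dsimp only
  omega

theorem jordanBlock_mul_ofGrid {F : Type*} [CommRing F] {p q : ℕ} (lam : F) {U : ℕ → ℕ → F}
    (hU : ∀ j, U 0 j = 0) (i : Fin p) (j : Fin q) :
    (jordanBlock F p lam * ofGrid p q U) i j =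
      lam * U (p - i) (j + 1) + U (p - 1 - i) (j + 1) := by
  have hsplit : ∀ x : Fin p, jordanBlock F p lam i x * ofGrid p q U x j =
      (if i = x then lam * U (p - x) (j + 1) else 0) +
        (if (x : ℕ) = i + 1 then U (p - x) (j + 1) else 0) := by
    intro x
    simp only [jordanBlock, ofGrid, Matrix.of_apply, Fin.ext_iff]
    split_ifs <;> first | omega | simp
  rw [Matrix.mul_apply, Finset.sum_congr rfl fun x _ => hsplit x, Finset.sum_add_distrib,
    Finset.sum_ite_eq, if_pos (Finset.mem_univ _)]
  congr 1
  by_cases h : (i : ℕ) + 1 < p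
  · rw [Finset.sum_eq_single ⟨i + 1, h⟩ (fun x _ hx => if_neg fun hx' => hx (Fin.ext hx'))
      (by simp), if_pos rfl]
    congr 1
    dsimp only
    omega
  · rw [Finset.sum_eq_zero fun x _ => if_neg (by omega), show p - 1 - (i : ℕ) = 0 by omega, hU]

theorem ofGrid_mul_jordanBlock_zero {F : Type*} [CommRing F] {p q : ℕ} {U : ℕ → ℕ → F}
    (hU : ∀ k, U k 0 = 0) (i : Fin p) (j : Fin q) :
    (ofGrid p q U * jordanBlock F q 0) i j = U (p - i) j := by
  have hentry : ∀ x : Fin q, ofGrid p q U i x * jordanBlock F q 0 x j =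
      if (j : ℕ) = x + 1 then U (p - i) j else 0 := by
    intro x
    simp only [jordanBlock, ofGrid, Matrix.of_apply]
    split_ifs <;> first | omega | simp_all
  rw [Matrix.mul_apply, Finset.sum_congr rfl fun x _ => hentry x]
  by_cases h : (j : ℕ) = 0
  · rw [Finset.sum_eq_zero fun x _ => if_neg (by omega), h, hU]
  · have hj := j.isLt
    rw [Finset.sum_eq_single ⟨j - 1, by omega⟩
      (fun x _ hx => if_neg fun hx' => hx (Fin.ext (by dsimp only; omega))) (by simp),
      if_pos (by dsimp only; omega)]

/-- For `lam ≠ 0` the Sylvester operator `S ↦ J_p(lam) S - S J_q` is surjective. -/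
theorem exists_add_mul_jordanBlock_sub_eq_zero {F : Type*} [Field F] {p q : ℕ} {lam : F}
    (hlam : lam ≠ 0) (A : Matrix (Fin p) (Fin q) F) :
    ∃ S : Matrix (Fin p) (Fin q) F,
      A + S * jordanBlock F q 0 - jordanBlock F p lam * S = 0 := by
  obtain ⟨a, -, -, rfl⟩ := exists_ofGrid_eq A
  let U : ℕ → ℕ → F := Nat.rec (fun _ => 0) fun k V =>
    Nat.rec 0 fun j x => lam⁻¹ * (a (k + 1) (j + 1) + x - V (j + 1))
  have hU₁ : ∀ j, U 0 j = 0 := fun _ => rfl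
  have hU₂ : ∀ k, U k 0 = 0 := by rintro (_ | k) <;> rfl
  have hU : ∀ k j, U (k + 1) (j + 1) = lam⁻¹ * (a (k + 1) (j + 1) + U (k + 1) j - U k (j + 1)) :=
    fun _ _ => rfl
  refine ⟨ofGrid p q U, ?_⟩
  ext i j
  rw [Matrix.sub_apply, Matrix.add_apply, jordanBlock_mul_ofGrid lam hU₁,
    ofGrid_mul_jordanBlock_zero hU₂, ofGrid, Matrix.of_apply, Matrix.zero_apply,
    show p - (i : ℕ) = p - 1 - i + 1 by omega, hU, mul_inv_cancel_left₀ hlam]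
  ring

/-- The matrices of form (5.1) meet every coset of the range of `S ↦ J_p S - S J_q`. -/
theorem exists_isForm51_add_mul_jordanBlock_sub {F : Type*} [CommRing F] {p q : ℕ}
    (A : Matrix (Fin p) (Fin q) F) :
    ∃ S : Matrix (Fin p) (Fin q) F,
      IsForm51 (A + S * jordanBlock F q 0 - jordanBlock F p 0 * S) := by
  obtain ⟨a, -, -, rfl⟩ := exists_ofGrid_eq A
  unfold IsForm51
  split_ifs with hpq
  · let U : ℕ → ℕ → F := Nat.rec (fun _ => 0) fun k V j =>
      if j = 0 then 0 else V (j + 1) - a (k + 1) (j + 1)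
    have hU₁ : ∀ j, U 0 j = 0 := fun _ => rfl
    have hU₂ : ∀ k, U k 0 = 0 := by rintro (_ | k) <;> rfl
    have hU : ∀ k j, j ≠ 0 → U (k + 1) j = U k (j + 1) - a (k + 1) (j + 1) :=
      fun _ _ hj => if_neg hj
    refine ⟨ofGrid p q U, fun i j hj => ?_⟩
    rw [Matrix.sub_apply, Matrix.add_apply, jordanBlock_mul_ofGrid 0 hU₁,
      ofGrid_mul_jordanBlock_zero hU₂, ofGrid, Matrix.of_apply,
      show p - (i : ℕ) = p - 1 - i + 1 by omega, hU _ _ hj]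
    ring
  · let W : ℕ → ℕ → F := Nat.rec (fun _ => 0) fun j V k =>
      if k = 0 then 0 else a (k + 1) (j + 1) + V (k + 1)
    have hW₁ : ∀ k, W 0 k = 0 := fun _ => rfl
    have hW₂ : ∀ j, W j 0 = 0 := by rintro (_ | j) <;> rfl
    have hW : ∀ j k, k ≠ 0 → W (j + 1) k = a (k + 1) (j + 1) + W j (k + 1) :=
      fun _ _ hk => if_neg hk
    refine ⟨ofGrid p q fun k j => W j k, fun i j hi => ?_⟩
    rw [Matrix.sub_apply, Matrix.add_apply, jordanBlock_mul_ofGrid 0 hW₂,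
      ofGrid_mul_jordanBlock_zero hW₁, ofGrid, Matrix.of_apply, hW _ (p - 1 - i) (by omega),
      show p - (i : ℕ) = p - 1 - i + 1 by omega]
    ring

/-- The range of `S ↦ J_p S - S J_q` contains no nonzero matrix of form (5.1). -/
theorem IsForm51.eq_zero_of_eq_mul_jordanBlock_sub {F : Type*} [CommRing F] {p q : ℕ}
    {H S : Matrix (Fin p) (Fin q) F} (hH : IsForm51 H)
    (h : H = S * jordanBlock F q 0 - jordanBlock F p 0 * S) : H = 0 := by
  obtain ⟨U, hU₁, hU₂, rfl⟩ := exists_ofGrid_eq S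
  have hHU : ∀ (i : Fin p) (j : Fin q), H i j = U (p - 1 - i + 1) j - U (p - 1 - i) (j + 1) := by
    intro i j
    rw [h, Matrix.sub_apply, jordanBlock_mul_ofGrid 0 hU₁, ofGrid_mul_jordanBlock_zero hU₂,
      show p - (i : ℕ) = p - 1 - i + 1 by omega, zero_mul, zero_add]
  ext i j
  rw [Matrix.zero_apply]
  unfold IsForm51 at hH
  split_ifs at hH with hpq
  · by_cases hj : (j : ℕ) = 0
    · have hstep : ∀ k l, k < p → l < q → l ≠ 0 → U (k + 1) l = U k (l + 1) := by
        intro k l hk hl hl0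
        have := hHU ⟨p - 1 - k, by omega⟩ ⟨l, hl⟩
        rw [hH _ _ hl0, show p - 1 - (p - 1 - k) = k by omega] at this
        exact sub_eq_zero.mp this.symm
      have hzero : ∀ k l, k + l ≤ p → l ≠ 0 → U k l = 0 := by
        intro k
        induction k with
        | zero => exact fun l _ _ => hU₁ l
        | succ k ih =>
          intro l hl hl0
          rw [hstep k l (by omega) (by omega) hl0, ih _ (by omega) (by omega)]
      rw [hHU, hj, hU₂, hzero _ _ (by omega) (by omega), sub_zero]
    · exact hH i j hj
  · by_cases hi : (i : ℕ) = p - 1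
    · have hstep : ∀ k l, k < p → l < q → k ≠ 0 → U k (l + 1) = U (k + 1) l := by
        intro k l hk hl hk0
        have := hHU ⟨p - 1 - k, by omega⟩ ⟨l, hl⟩
        rw [hH _ _ (by dsimp only; omega), show p - 1 - (p - 1 - k) = k by omega] at this
        exact (sub_eq_zero.mp this.symm).symm
      have hzero : ∀ l k, k + l ≤ q → k ≠ 0 → U k l = 0 := by
        intro l
        induction l with
        | zero => exact fun k _ _ => hU₂ k
        | succ l ih =>
          intro k hk hk0
          rw [hstep k l (by omega) (by omega) hk0, ih _ (by omega) (by omega)]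
      have hj := j.isLt
      rw [hHU, hi, Nat.sub_self, hU₁, hzero _ _ (by omega) (by omega), sub_zero]
    · exact hH i j hi

theorem IsForm51.sub {F : Type*} [AddGroup F] {p q : ℕ} {H H' : Matrix (Fin p) (Fin q) F}
    (hH : IsForm51 H) (hH' : IsForm51 H') : IsForm51 (H - H') := by
  unfold IsForm51 at *
  split_ifs at * <;> intro i j h <;> rw [Matrix.sub_apply, hH i j h, hH' i j h, sub_zero]

/-- Case 2 of the paper's Theorem 4.1: interaction of the contragredient summands
`(I_p, J_p(λ))` and `(J_q, I_q)`. -/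
theorem contragredient_case2 (F : Type*) [RCLike F] (p q : ℕ) (hp : 1 ≤ p) (hq : 1 ≤ q)
    (lam : F) (M N : Matrix (Fin p) (Fin q) F) :
    (lam ≠ 0 → ∃ S R : Matrix (Fin p) (Fin q) F,
        M + S * jordanBlock F q 0 - R = 0 ∧
        N + R - jordanBlock F p lam * S = 0) ∧
    (lam = 0 →
      (∃ (S R H : Matrix (Fin p) (Fin q) F), IsForm51 H ∧
          M + S * jordanBlock F q 0 - R = 0 ∧
          N + R - jordanBlock F p 0 * S = H) ∧
      (∀ S R H S' R' H' : Matrix (Fin p) (Fin q) F, IsForm51 H → IsForm51 H' →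
          M + S * jordanBlock F q 0 - R = 0 →
          N + R - jordanBlock F p 0 * S = H →
          M + S' * jordanBlock F q 0 - R' = 0 →
          N + R' - jordanBlock F p 0 * S' = H' → H = H')) := by
  refine ⟨fun hlam => ?_, fun _ => ⟨?_, ?_⟩⟩
  · obtain ⟨S, hS⟩ := exists_add_mul_jordanBlock_sub_eq_zero hlam (M + N)
    refine ⟨S, M + S * jordanBlock F q 0, sub_self _, ?_⟩
    rw [← hS]
    abel
  · obtain ⟨S, hS⟩ := exists_isForm51_add_mul_jordanBlock_sub (M + N)
    refine ⟨S, M + S * jordanBlock F q 0, _, hS, sub_self _, ?_⟩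
    abel
  · intro S R H S' R' H' hH hH' hR hN hR' hN'
    refine sub_eq_zero.mp ((hH.sub hH').eq_zero_of_eq_mul_jordanBlock_sub (S := S - S') ?_)
    rw [← hN, ← hN', ← sub_eq_zero.mp hR, ← sub_eq_zero.mp hR', Matrix.sub_mul, Matrix.mul_sub]
    abel
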